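/- Let (A, ▷) be a Lie admissible triple algebra with triple bracket [x,y,z] := ass(x,y,z) − ass(y,x,z). Let Der(A) be the span of the maps D_{x,y}: z ↦ [x,y,z] and let L = Der(A) ⊕ A with Lie bracket [x,y] = D_{x,y}, [A',x] = −A'(x), [A',B'] = −A'∘B' + B'∘A' for x,y ∈ A and A',B' ∈ Der(A). Extend ▷ to ▶ on L by x▶y = x▷y, A'▶x = A'(x), (x▶A')(y) = x▶A'(y) − A'(x▶y), and A'▶B' = A'∘B' − B'∘A'. Then (L, [_,_], ▶) is a post-Lie algebra. -/

import Mathlib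

attribute [local instance] LieRing.ofAssociativeRing

/-- The operator `z ↦ ass(x, y, z) - ass(y, x, z)` of a bilinear product, as a bilinear map. -/
def tripleOperator {K V : Type*} [Field K] [AddCommGroup V] [Module K V]
    (op : V →ₗ[K] V →ₗ[K] V) : V →ₗ[K] V →ₗ[K] Module.End K V :=
  LinearMap.mk₂ K (fun x y => op x ∘ₗ op y - op (op x y) - op y ∘ₗ op x + op (op y x))
    (fun x x' y => by ext z; simp; abel)
    (fun c x y => by ext z; simp [smul_sub, smul_add])
    (fun x y y' => by ext z; simp; abel)
    (fun c x y => by ext z; simp [smul_sub, smul_add])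

theorem tripleOperator_apply {K V : Type*} [Field K] [AddCommGroup V] [Module K V]
    (op : V →ₗ[K] V →ₗ[K] V) (x y : V) :
    tripleOperator op x y = op x ∘ₗ op y - op (op x y) - op y ∘ₗ op x + op (op y x) := rfl

theorem tripleOperator_eq_lie {K V : Type*} [Field K] [AddCommGroup V] [Module K V]
    (op : V →ₗ[K] V →ₗ[K] V) (x y : V) :
    tripleOperator op x y =
      ⁅(op x : Module.End K V), (op y : Module.End K V)⁆ - op (op x y) + op (op y x) := by
  ext z
  simp [tripleOperator_apply, Ring.lie_def]
  abel

theorem tripleOperator_self {K V : Type*} [Field K] [AddCommGroup V] [Module K V]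
    (op : V →ₗ[K] V →ₗ[K] V) (x : V) : tripleOperator op x x = 0 := by
  simp [tripleOperator_eq_lie]

theorem tripleOperator_swap {K V : Type*} [Field K] [AddCommGroup V] [Module K V]
    (op : V →ₗ[K] V →ₗ[K] V) (x y : V) :
    tripleOperator op x y = -tripleOperator op y x := by
  simp only [tripleOperator_apply]
  abel

/-- The derivations of a triple bracket given by a bilinear family of operators. -/
def tripleDerivations {K V : Type*} [Field K] [AddCommGroup V] [Module K V]
    (T : V →ₗ[K] V →ₗ[K] Module.End K V) : LieSubalgebra K (Module.End K V) where
  carrier := {f | ∀ x y, ⁅f, T x y⁆ = T (f x) y + T x (f y)}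
  zero_mem' := by intro x y; simp
  add_mem' := by
    intro f g hf hg x y
    simp only [Set.mem_ofPred_eq] at hf hg
    simp only [add_lie, hf, hg, LinearMap.add_apply, map_add]
    abel
  smul_mem' := by
    intro c f hf x y
    simp only [Set.mem_ofPred_eq] at hf
    simp only [smul_lie, hf, LinearMap.smul_apply, map_smul, smul_add]
  lie_mem' := by
    intro f g hf hg x y
    change ∀ x y, ⁅f, T x y⁆ = T (f x) y + T x (f y) at hf
    change ∀ x y, ⁅g, T x y⁆ = T (g x) y + T x (g y) at hg
    rw [lie_lie]
    simp only [hf, hg, lie_add, Ring.lie_def f g, LinearMap.sub_apply,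
      Module.End.mul_apply, map_sub]
    abel

theorem mem_tripleDerivations {K V : Type*} [Field K] [AddCommGroup V] [Module K V]
    {T : V →ₗ[K] V →ₗ[K] Module.End K V} {f : Module.End K V} :
    f ∈ tripleDerivations T ↔ ∀ x y, ⁅f, T x y⁆ = T (f x) y + T x (f y) := Iff.rfl

theorem lie_mem_span_of_mem_tripleDerivations {K V : Type*} [Field K] [AddCommGroup V]
    [Module K V] {T : V →ₗ[K] V →ₗ[K] Module.End K V} {f : Module.End K V}
    (hf : f ∈ tripleDerivations T) {g : Module.End K V}
    (hg : g ∈ Submodule.span K {h : Module.End K V | ∃ x y, h = T x y}) :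
    ⁅f, g⁆ ∈ Submodule.span K {h : Module.End K V | ∃ x y, h = T x y} := by
  induction hg using Submodule.span_induction with
  | mem g hg =>
    obtain ⟨x, y, rfl⟩ := hg
    rw [mem_tripleDerivations.1 hf]
    exact add_mem (Submodule.subset_span ⟨_, _, rfl⟩) (Submodule.subset_span ⟨_, _, rfl⟩)
  | zero => simp
  | add g h _ _ hg hh => rw [lie_add]; exact add_mem hg hh
  | smul c g _ hg => rw [lie_smul]; exact Submodule.smul_mem _ c hg

theorem span_tripleOperator_le_tripleDerivations {K V : Type*} [Field K] [AddCommGroup V]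
    [Module K V] {op : V →ₗ[K] V →ₗ[K] V}
    (hop : ∀ x, (op x : Module.End K V) ∈ tripleDerivations (tripleOperator op)) :
    Submodule.span K {h : Module.End K V | ∃ x y, h = tripleOperator op x y} ≤
      (tripleDerivations (tripleOperator op)).toSubmodule := by
  rw [Submodule.span_le]
  rintro _ ⟨x, y, rfl⟩
  rw [tripleOperator_eq_lie]
  exact add_mem (sub_mem (LieSubalgebra.lie_mem _ (hop x) (hop y)) (hop _)) (hop _)


/-- Embedding of a Lie admissible triple algebra `(V,▷)` into a post-Lie algebra on
`L = Der(V) ⊕ V`, with the bracket and extended product given componentwise as in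
Theorem 8.5. -/
theorem lat_embeds_into_postLie {K V : Type*} [Field K] [AddCommGroup V] [Module K V]
    (op : V →ₗ[K] V →ₗ[K] V)
    (hLAT1 : ∀ x y z : V,
      ((op x (op y z) - op (op x y) z) - (op y (op x z) - op (op y x) z))
      + ((op y (op z x) - op (op y z) x) - (op z (op y x) - op (op z y) x))
      + ((op z (op x y) - op (op z x) y) - (op x (op z y) - op (op x z) y)) = 0)
    (hLAT2 : ∀ w x y z : V,
      op w ((op x (op y z) - op (op x y) z) - (op y (op x z) - op (op y x) z)) =
        ((op (op w x) (op y z) - op (op (op w x) y) z)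
          - (op y (op (op w x) z) - op (op y (op w x)) z))
        + ((op x (op (op w y) z) - op (op x (op w y)) z)
          - (op (op w y) (op x z) - op (op (op w y) x) z))
        + ((op x (op y (op w z)) - op (op x y) (op w z))
          - (op y (op x (op w z)) - op (op y x) (op w z)))) :
    let D : V → V → (V →ₗ[K] V) :=
      fun x y => op x ∘ₗ op y - op (op x y) - op y ∘ₗ op x + op (op y x)
    let Der := Submodule.span K {f : V →ₗ[K] V | ∃ x y : V, f = D x y}
    ∃ br bt : (↥Der × V) → (↥Der × V) → (↥Der × V),
      -- bilinearity of the bracket and of the product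
      (∀ p q r, br (p + q) r = br p r + br q r) ∧
      (∀ p q r, br p (q + r) = br p q + br p r) ∧
      (∀ (c : K) p q, br (c • p) q = c • br p q) ∧
      (∀ (c : K) p q, br p (c • q) = c • br p q) ∧
      (∀ p q r, bt (p + q) r = bt p r + bt q r) ∧
      (∀ p q r, bt p (q + r) = bt p q + bt p r) ∧
      (∀ (c : K) p q, bt (c • p) q = c • bt p q) ∧
      (∀ (c : K) p q, bt p (c • q) = c • bt p q) ∧
      -- componentwise formulas for the bracket
      (∀ x y : V, ((br (0, x) (0, y)).1 : V →ₗ[K] V) = D x y ∧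
        (br ((0 : ↥Der), x) ((0 : ↥Der), y)).2 = 0) ∧
      (∀ (A' : ↥Der) (x : V),
        br (A', (0 : V)) ((0 : ↥Der), x) = ((0 : ↥Der), -((A' : V →ₗ[K] V) x))) ∧
      (∀ A' B' : ↥Der,
        ((br (A', (0 : V)) (B', (0 : V))).1 : V →ₗ[K] V) =
          -((A' : V →ₗ[K] V) ∘ₗ (B' : V →ₗ[K] V))
            + (B' : V →ₗ[K] V) ∘ₗ (A' : V →ₗ[K] V) ∧
        (br (A', (0 : V)) (B', (0 : V))).2 = 0) ∧
      -- componentwise formulas for the product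
      (∀ x y : V, bt ((0 : ↥Der), x) ((0 : ↥Der), y) = ((0 : ↥Der), op x y)) ∧
      (∀ (A' : ↥Der) (x : V),
        bt (A', (0 : V)) ((0 : ↥Der), x) = ((0 : ↥Der), (A' : V →ₗ[K] V) x)) ∧
      (∀ (x : V) (A' : ↥Der),
        (bt ((0 : ↥Der), x) (A', (0 : V))).2 = 0 ∧
        ∀ y : V, ((bt ((0 : ↥Der), x) (A', (0 : V))).1 : V →ₗ[K] V) y =
          op x ((A' : V →ₗ[K] V) y) - (A' : V →ₗ[K] V) (op x y)) ∧
      (∀ A' B' : ↥Der,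
        ((bt (A', (0 : V)) (B', (0 : V))).1 : V →ₗ[K] V) =
          (A' : V →ₗ[K] V) ∘ₗ (B' : V →ₗ[K] V)
            - (B' : V →ₗ[K] V) ∘ₗ (A' : V →ₗ[K] V) ∧
        (bt (A', (0 : V)) (B', (0 : V))).2 = 0) ∧
      -- br is a Lie bracket
      (∀ p, br p p = 0) ∧
      (∀ p q r, br p (br q r) + br q (br r p) + br r (br p q) = 0) ∧
      -- post-Lie axioms
      (∀ p q r, bt (br p q) r =
        bt p (bt q r) - bt (bt p q) r - (bt q (bt p r) - bt (bt q p) r)) ∧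
      (∀ p q r, bt p (br q r) = br (bt p q) r + br q (bt p r)) := by
  intro D Der
  have hT : ∀ x y, D x y = tripleOperator op x y := fun x y => rfl
  have hop : ∀ x, (op x : Module.End K V) ∈ tripleDerivations (tripleOperator op) := by
    intro w
    rw [mem_tripleDerivations]
    intro x y
    ext z
    have h := hLAT2 w x y z
    simp only [Ring.lie_def, LinearMap.sub_apply, Module.End.mul_apply, LinearMap.add_apply,
      tripleOperator_apply, LinearMap.comp_apply, map_sub, map_add] at h ⊢
    rw [← sub_eq_zero] at h ⊢
    rw [← h]
    abel
  have hcyc : ∀ x y z, tripleOperator op x y z + tripleOperator op y z x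
      + tripleOperator op z x y = 0 := by
    intro x y z
    rw [← hLAT1 x y z]
    simp only [LinearMap.sub_apply, LinearMap.add_apply,
      tripleOperator_apply, LinearMap.comp_apply]
    abel
  have hmem : ∀ x y, tripleOperator op x y ∈ Der := fun x y => Submodule.subset_span ⟨x, y, rfl⟩
  have hDer : ∀ f : Module.End K V, f ∈ Der → f ∈ tripleDerivations (tripleOperator op) :=
    fun f hf => span_tripleOperator_le_tripleDerivations hop hf
  have hlie : ∀ f g : Module.End K V, f ∈ tripleDerivations (tripleOperator op) → g ∈ Der →
      ⁅f, g⁆ ∈ Der := fun f g hf hg => lie_mem_span_of_mem_tripleDerivations hf hg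
  let ρ : ↥Der × V → Module.End K V := fun p => (p.1 : Module.End K V) + op p.2
  have hρ : ∀ p, ρ p ∈ tripleDerivations (tripleOperator op) :=
    fun p => add_mem (hDer _ p.1.2) (hop _)
  let br : ↥Der × V → ↥Der × V → ↥Der × V := fun p q =>
    (⟨tripleOperator op p.2 q.2 - ⁅(p.1 : Module.End K V), (q.1 : Module.End K V)⁆,
      sub_mem (hmem _ _) (hlie _ _ (hDer _ p.1.2) q.1.2)⟩,
      (q.1 : Module.End K V) p.2 - (p.1 : Module.End K V) q.2)
  let bt : ↥Der × V → ↥Der × V → ↥Der × V := fun p q =>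
    (⟨⁅ρ p, (q.1 : Module.End K V)⁆, hlie _ _ (hρ p) q.1.2⟩, ρ p q.2)
  have ext' : ∀ p q : ↥Der × V,
      (p.1 : Module.End K V) = (q.1 : Module.End K V) → p.2 = q.2 → p = q :=
    fun p q h h' => Prod.ext (Subtype.ext h) h'
  have br₁ : ∀ p q, ((br p q).1 : Module.End K V) =
      tripleOperator op p.2 q.2 - ⁅(p.1 : Module.End K V), (q.1 : Module.End K V)⁆ :=
    fun _ _ => rfl
  have br₂ : ∀ p q, (br p q).2 = (q.1 : Module.End K V) p.2 - (p.1 : Module.End K V) q.2 :=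
    fun _ _ => rfl
  have bt₁ : ∀ p q, ((bt p q).1 : Module.End K V) = ⁅ρ p, (q.1 : Module.End K V)⁆ :=
    fun _ _ => rfl
  have bt₂ : ∀ p q, (bt p q).2 = ρ p q.2 := fun _ _ => rfl
  have ρ_def : ∀ p, ρ p = (p.1 : Module.End K V) + op p.2 := fun _ => rfl
  have ρ_add : ∀ p q, ρ (p + q) = ρ p + ρ q := by
    intro p q
    simp only [ρ_def, Prod.fst_add, Prod.snd_add, Submodule.coe_add, map_add]
    abel
  have ρ_smul : ∀ (c : K) p, ρ (c • p) = c • ρ p := by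
    intro c p
    simp only [ρ_def, Prod.smul_fst, Prod.smul_snd, Submodule.coe_smul, map_smul, smul_add]
  have ρ_br : ∀ p q, ρ (br p q) = ⁅ρ p, ρ q⁆ - ρ (bt p q) + ρ (bt q p) := by
    intro p q
    simp only [ρ_def, br₁, br₂, bt₁, bt₂, tripleOperator_eq_lie, map_sub, map_add, lie_add,
      add_lie, LinearMap.add_apply]
    rw [← lie_skew (q.1 : Module.End K V) (p.1 : Module.End K V),
      ← lie_skew (op q.2 : Module.End K V) (p.1 : Module.End K V)]
    abel
  clear_value br bt ρ
  refine ⟨br, bt, ?_, ?_, ?_, ?_, ?_, ?_, ?_, ?_, ?_, ?_, ?_, ?_, ?_, ?_, ?_, ?_, ?_, ?_, ?_⟩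
  · intro p q r
    apply ext'
    · simp only [br₁, Prod.fst_add, Prod.snd_add, Submodule.coe_add, map_add, add_lie,
        LinearMap.add_apply]
      abel
    · simp only [br₂, Prod.fst_add, Prod.snd_add, Submodule.coe_add, map_add,
        LinearMap.add_apply]
      abel
  · intro p q r
    apply ext'
    · simp only [br₁, Prod.fst_add, Prod.snd_add, Submodule.coe_add, map_add, lie_add]
      abel
    · simp only [br₂, Prod.fst_add, Prod.snd_add, Submodule.coe_add, map_add,
        LinearMap.add_apply]
      abel
  · intro c p q
    apply ext' <;> simp [br₁, br₂, smul_sub]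
  · intro c p q
    apply ext' <;> simp [br₁, br₂, smul_sub]
  · intro p q r
    apply ext' <;> simp [bt₁, bt₂, ρ_add]
  · intro p q r
    apply ext' <;> simp [bt₁, bt₂]
  · intro c p q
    apply ext' <;> simp [bt₁, bt₂, ρ_smul]
  · intro c p q
    apply ext' <;> simp [bt₁, bt₂]
  · intro x y
    exact ⟨by simp [br₁, hT], by simp [br₂]⟩
  · intro A x
    apply ext' <;> simp [br₁, br₂]
  · intro A B
    refine ⟨?_, by simp [br₂]⟩
    ext z
    simp [br₁, Ring.lie_def]
    abel
  · intro x y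
    apply ext' <;> simp [bt₁, bt₂, ρ_def]
  · intro A x
    apply ext' <;> simp [bt₁, bt₂, ρ_def]
  · intro x A
    exact ⟨by simp [bt₂], fun y => by simp [bt₁, ρ_def, Ring.lie_def]⟩
  · intro A B
    refine ⟨?_, by simp [bt₂]⟩
    ext z
    simp [bt₁, ρ_def, Ring.lie_def]
  · intro p
    apply ext' <;> simp [br₁, br₂, tripleOperator_self]
  · intro p q r
    apply ext'
    · have hD : ∀ (s : ↥Der × V) (x y : V), ⁅(s.1 : Module.End K V), tripleOperator op x y⁆ =
          tripleOperator op ((s.1 : Module.End K V) x) y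
            + tripleOperator op x ((s.1 : Module.End K V) y) := fun s => hDer _ s.1.2
      have hJ := lie_jacobi (p.1 : Module.End K V) (q.1 : Module.End K V) (r.1 : Module.End K V)
      simp only [br₁, br₂, Prod.fst_add, Submodule.coe_add, map_sub, lie_sub, hD,
        Prod.fst_zero, Submodule.coe_zero]
      rw [tripleOperator_swap op p.2 ((q.1 : Module.End K V) r.2),
        tripleOperator_swap op q.2 ((r.1 : Module.End K V) p.2),
        tripleOperator_swap op r.2 ((p.1 : Module.End K V) q.2), ← hJ]
      abel
    · simp only [br₁, br₂, Prod.snd_add, map_sub, LinearMap.sub_apply, Ring.lie_def,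
        Module.End.mul_apply, Prod.snd_zero]
      rw [← hcyc p.2 q.2 r.2]
      abel
  · intro p q r
    apply ext'
    · simp only [bt₁, ρ_br, Prod.fst_sub, Submodule.coe_sub, add_lie, sub_lie, lie_lie]
      abel
    · simp only [bt₂, ρ_br, Prod.snd_sub, LinearMap.add_apply, LinearMap.sub_apply,
        Ring.lie_def, Module.End.mul_apply]
      abel
  · intro p q r
    have hD := mem_tripleDerivations.1 (hρ p)
    apply ext'
    · simp only [bt₁, br₁, bt₂, Prod.fst_add, Submodule.coe_add, lie_sub, hD]
      rw [leibniz_lie (ρ p) (q.1 : Module.End K V)]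
      abel
    · simp only [bt₁, bt₂, br₂, Prod.snd_add, map_sub, LinearMap.sub_apply,
        Ring.lie_def, Module.End.mul_apply]
      abel
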